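/- Every automorphism of the alternating group A₇ is induced by conjugation by an element of the symmetric group S₇; that is, the natural map S₇ → Aut(A₇) is surjective (indeed an isomorphism). -/

import Mathlib

open Equiv

namespace AlternatingSeven

/-- The permutation `a ↦ b ↦ c ↦ a`, a three-cycle when `a`, `b`, `c` are distinct. -/
def tricycle (a b c : Fin 7) : Perm (Fin 7) := swap a b * swap b c

theorem conj_tricycle (g : Perm (Fin 7)) (a b c : Fin 7) :
    g * tricycle a b c * g⁻¹ = tricycle (g a) (g b) (g c) := by
  simp only [tricycle, swap_apply_apply]
  group

theorem tricycle_rotate {a b c : Fin 7} (hab : a ≠ b) (hac : a ≠ c) (hbc : b ≠ c) :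
    tricycle a b c = tricycle b c a := by
  revert a b c
  decide +kernel

theorem tricycle_inv (a b c : Fin 7) : (tricycle a b c)⁻¹ = tricycle c b a := by
  simp [tricycle, swap_comm]

theorem exists_perm_extending {n : ℕ} {u v : Fin n → Fin 7} (hu : u.Injective)
    (hv : v.Injective) : ∃ g : Perm (Fin 7), ∀ i, g (u i) = v i := by
  have := Equiv.Perm.isMultiplyPretransitive (Fin 7) n
  obtain ⟨g, hg⟩ := MulAction.exists_smul_eq (Perm (Fin 7)) (⟨u, hu⟩ : Fin n ↪ Fin 7) ⟨v, hv⟩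
  exact ⟨g, fun i => DFunLike.congr_fun hg i⟩

theorem exists_eq_replicate_of_forall_mem {m : Multiset ℕ}
    (hm : ∀ x ∈ m, x = 2 ∨ x = 3 ∨ x = 6) :
    ∃ a b c, m = .replicate a 2 + .replicate b 3 + .replicate c 6 := by
  induction m using Multiset.induction_on with
  | empty => exact ⟨0, 0, 0, rfl⟩
  | cons x m ih =>
    obtain ⟨a, b, c, h⟩ := ih fun x hx => hm x (Multiset.mem_cons_of_mem hx)
    rcases hm x (Multiset.mem_cons_self x m) with rfl | rfl | rfl
    · exact ⟨a + 1, b, c, by simp [h, Multiset.replicate_succ]⟩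
    · exact ⟨a, b + 1, c, by simp [h, Multiset.replicate_succ]⟩
    · exact ⟨a, b, c + 1, by simp [h, Multiset.replicate_succ]⟩

/-- An even permutation of seven letters of order six has cycle type `{2, 2, 3}`. -/
theorem cycleType_of_orderOf_eq_six {y : Perm (Fin 7)} (hs : Perm.sign y = 1)
    (hy : orderOf y = 6) : y.cycleType = {2, 2, 3} := by
  obtain ⟨a, b, c, h⟩ := exists_eq_replicate_of_forall_mem (m := y.cycleType) fun x hx => by
    have hdvd : x ∣ 6 := hy ▸ Perm.dvd_of_mem_cycleType hx
    have htwo := Perm.two_le_of_mem_cycleType hx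
    have hle := Nat.le_of_dvd (by norm_num) hdvd
    interval_cases x <;> omega
  have hsum : y.cycleType.sum ≤ 7 := by
    rw [Perm.sum_cycleType]
    exact Finset.card_le_univ _
  have hlcm := Perm.lcm_cycleType y
  rw [Perm.sign_of_cycleType] at hs
  rw [hy] at hlcm
  rw [h] at hsum hlcm hs ⊢
  have hbound : a * 2 + b * 3 + c * 6 ≤ 7 := by
    simpa using hsum
  have ha : a ≤ 3 := by omega
  have hb : b ≤ 2 := by omega
  have hc : c ≤ 1 := by omega
  clear h hsum hy
  revert hs hlcm hbound
  interval_cases a <;> interval_cases b <;> interval_cases c <;> decide +kernel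

theorem exists_conj_of_orderOf_eq_six {y : Perm (Fin 7)} (hs : Perm.sign y = 1)
    (hy : orderOf y = 6) : ∃ g : Perm (Fin 7), y ^ 4 = g * tricycle 0 1 2 * g⁻¹ := by
  have h : IsConj (tricycle 0 1 2 * (swap 3 4 * swap 5 6)) y := by
    rw [Perm.isConj_iff_cycleType_eq, cycleType_of_orderOf_eq_six hs hy]
    refine cycleType_of_orderOf_eq_six (by decide +kernel) ?_
    rw [orderOf_eq_iff (by norm_num)]
    decide +kernel
  have hpow : (tricycle 0 1 2 * (swap 3 4 * swap 5 6)) ^ 4 = tricycle 0 1 2 := by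
    decide +kernel
  obtain ⟨g, hg⟩ := isConj_iff.1 h
  exact ⟨g, by rw [← hg, conj_pow, hpow]⟩

/-- The generators `(0 1 i)` of the alternating group. -/
def gen (i : Fin 5) : alternatingGroup (Fin 7) :=
  ⟨tricycle 0 1 i.succ.succ, Perm.mem_alternatingGroup.2 (by revert i; decide +kernel)⟩

theorem exists_orderOf_six_pow_four (i : Fin 5) :
    ∃ y : alternatingGroup (Fin 7), orderOf y = 6 ∧ y ^ 4 = gen i := by
  have key : ∃ y : Perm (Fin 7), (Perm.sign y = 1 ∧ orderOf y = 6) ∧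
      y ^ 4 = tricycle 0 1 i.succ.succ := by
    let y₀ : Perm (Fin 7) := tricycle 0 1 2 * (swap 3 4 * swap 5 6)
    refine ⟨swap 2 i.succ.succ * y₀ * (swap 2 i.succ.succ)⁻¹, ⟨?_, ?_⟩, ?_⟩
    · revert i
      decide +kernel
    · rw [orderOf_eq_iff (by norm_num)]
      revert i
      decide +kernel
    · revert i
      decide +kernel
  obtain ⟨y, ⟨hs, ho⟩, hp⟩ := key
  exact ⟨⟨y, hs⟩, by rw [← ho]; exact Subgroup.orderOf_mk _ _, Subtype.ext hp⟩

theorem exists_image_gen_eq_conj (φ : MulAut (alternatingGroup (Fin 7))) (i : Fin 5) :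
    ∃ g : Perm (Fin 7), (φ (gen i) : Perm (Fin 7)) = g * tricycle 0 1 2 * g⁻¹ := by
  obtain ⟨y, hy, hyi⟩ := exists_orderOf_six_pow_four i
  rw [← hyi, map_pow, Subgroup.coe_pow]
  refine exists_conj_of_orderOf_eq_six (φ y).2 ?_
  rw [Subgroup.orderOf_coe, ← hy]
  exact MulEquiv.orderOf_eq φ y

theorem tricycle_mem {L : Subgroup (Perm (Fin 7))}
    (hL : ∀ i, i ≠ 0 → i ≠ 1 → tricycle 0 1 i ∈ L) {a b c : Fin 7}
    (hab : a ≠ b) (hac : a ≠ c) (hbc : b ≠ c) : tricycle a b c ∈ L := by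
  have conj_mem : ∀ g ∈ L, ∀ a b c, tricycle a b c ∈ L → tricycle (g a) (g b) (g c) ∈ L := by
    intro g hg a b c h
    rw [← conj_tricycle]
    exact L.mul_mem (L.mul_mem hg h) (L.inv_mem hg)
  have hval : ∀ i : Fin 7, i ≠ 0 → i ≠ 1 → tricycle 0 1 i 0 = 1 ∧ tricycle 0 1 i 1 = i ∧
      tricycle 0 1 i i = 0 ∧ ∀ j, j ≠ 0 → j ≠ 1 → j ≠ i → tricycle 0 1 i j = j := by
    decide +kernel
  have hone : ∀ i j : Fin 7, i ≠ 0 → i ≠ 1 → j ≠ 0 → j ≠ 1 → i ≠ j → tricycle 1 i j ∈ L := by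
    intro i j hi hi' hj hj' hij
    have := conj_mem _ (hL i hi hi') _ _ _ (hL j hj hj')
    grind
  have hrest : ∀ i j k : Fin 7, i ≠ 0 → i ≠ 1 → j ≠ 0 → j ≠ 1 → k ≠ 0 → k ≠ 1 → i ≠ j → i ≠ k →
      j ≠ k → tricycle i j k ∈ L := by
    intro i j k hi hi' hj hj' hk hk' hij hik hjk
    have := conj_mem _ (hL i hi hi') _ _ _ (hone j k hj hj' hk hk' hjk)
    grind
  have hzero : ∀ i j : Fin 7, i ≠ 0 → i ≠ 1 → j ≠ 0 → j ≠ 1 → i ≠ j → tricycle 0 i j ∈ L := by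
    intro i j hi hi' hj hj' hij
    have hv := hval j hj hj'
    have hfix := hv.2.2.2 i hi hi' hij
    have := conj_mem _ (L.mul_mem (hL j hj hj') (hL j hj hj')) _ _ _ (hL i hi hi')
    simp only [Perm.mul_apply] at this
    rwa [hv.1, hv.2.1, hv.2.2.1, hfix, hfix, tricycle_rotate hj hij.symm hi.symm] at this
  have hinv : ∀ i : Fin 7, i ≠ 0 → i ≠ 1 → tricycle i 1 0 ∈ L := by
    intro i hi hi'
    rw [← tricycle_inv]
    exact L.inv_mem (hL i hi hi')
  have hrot := @tricycle_rotate
  by_cases ha : a = 0 <;> by_cases ha' : a = 1 <;> by_cases hb : b = 0 <;>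
    by_cases hb' : b = 1 <;> by_cases hc : c = 0 <;> by_cases hc' : c = 1 <;> grind

theorem eq_top_of_gen_mem {K : Subgroup (alternatingGroup (Fin 7))} (hK : ∀ i, gen i ∈ K) :
    K = ⊤ := by
  rw [eq_top_iff, ← alternatingGroup.closure_isThreeCycles_eq_top, Subgroup.closure_le]
  intro x hx
  have hL : ∀ i, i ≠ 0 → i ≠ 1 → tricycle 0 1 i ∈ K.map (alternatingGroup (Fin 7)).subtype := by
    intro i hi hi'
    obtain ⟨j, rfl⟩ := Fin.exists_succ_eq.2 hi
    obtain ⟨k, rfl⟩ := Fin.exists_succ_eq.2 (fun h : j = 0 => hi' (by rw [h]; rfl))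
    exact ⟨gen k, hK k, rfl⟩
  have hconj : IsConj (tricycle 0 1 2) (x : Perm (Fin 7)) := by
    rw [Perm.isConj_iff_cycleType_eq, Perm.IsThreeCycle.cycleType hx]
    rw [← Perm.IsThreeCycle, ← card_support_eq_three_iff]
    decide +kernel
  obtain ⟨g, hg⟩ := isConj_iff.1 hconj
  obtain ⟨y, hy, hyx⟩ : (x : Perm (Fin 7)) ∈ K.map (alternatingGroup (Fin 7)).subtype := by
    rw [← hg, conj_tricycle]
    apply tricycle_mem hL <;> simp
  rwa [SetLike.mem_coe, ← Subtype.ext hyx]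

set_option synthInstance.maxSize 1000 in
/-- Two three-cycles whose product is an involution share an arrow. -/
theorem exists_common_arrow : ∀ p q r : Fin 7, p ≠ q → p ≠ r → q ≠ r →
    (tricycle 0 1 2 * tricycle p q r) ^ 2 = 1 → tricycle 0 1 2 * tricycle p q r ≠ 1 →
    ∃ y, y ≠ 0 ∧ y ≠ 1 ∧ y ≠ 2 ∧ (tricycle p q r = tricycle 0 1 y ∨
      tricycle p q r = tricycle 1 2 y ∨ tricycle p q r = tricycle 2 0 y) := by
  decide +kernel

theorem exists_eq_tricycle_zero_one : ∀ p q r : Fin 7, p ≠ q → p ≠ r → q ≠ r →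
    (tricycle 0 1 2 * tricycle p q r) ^ 2 = 1 → tricycle 0 1 2 * tricycle p q r ≠ 1 →
    (tricycle 0 1 3 * tricycle p q r) ^ 2 = 1 → tricycle 0 1 3 * tricycle p q r ≠ 1 →
    ∃ z, z ≠ 0 ∧ z ≠ 1 ∧ tricycle p q r = tricycle 0 1 z := by
  decide +kernel

theorem gen_mul_gen : ∀ i j : Fin 5, i ≠ j → (gen i * gen j) ^ 2 = 1 ∧ gen i * gen j ≠ 1 := by
  decide +kernel

theorem gen_injective : Function.Injective gen := by
  decide +kernel

theorem map_gen_mul_gen {ψ : alternatingGroup (Fin 7) →* Perm (Fin 7)}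
    (hψ : Function.Injective ψ) {i j : Fin 5} (hij : i ≠ j) :
    (ψ (gen i) * ψ (gen j)) ^ 2 = 1 ∧ ψ (gen i) * ψ (gen j) ≠ 1 := by
  obtain ⟨hsq, hne⟩ := gen_mul_gen i j hij
  rw [← map_mul, ← map_pow, hsq, map_one]
  exact ⟨rfl, fun h => hne (hψ (h.trans (map_one ψ).symm))⟩

theorem exists_conj_of_arrow {a b c y : Fin 7} (hab : a ≠ b) (hac : a ≠ c) (hbc : b ≠ c)
    (hay : a ≠ y) (hby : b ≠ y) (hcy : c ≠ y) :
    ∃ g : Perm (Fin 7), tricycle a b c = g * tricycle 0 1 2 * g⁻¹ ∧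
      tricycle a b y = g * tricycle 0 1 3 * g⁻¹ := by
  obtain ⟨g, hg⟩ := exists_perm_extending (u := ![0, 1, 2, 3]) (v := ![a, b, c, y])
    (by decide) (by
      intro i j
      fin_cases i <;> fin_cases j <;> simp_all [eq_comm])
  have h₀ : g 0 = a := hg 0
  have h₁ : g 1 = b := hg 1
  have h₂ : g 2 = c := hg 2
  have h₃ : g 3 = y := hg 3
  exact ⟨g, by rw [conj_tricycle, h₀, h₁, h₂], by rw [conj_tricycle, h₀, h₁, h₃]⟩

theorem exists_conj_gen_zero_one (φ : MulAut (alternatingGroup (Fin 7))) :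
    ∃ g : Perm (Fin 7), (φ (gen 0) : Perm (Fin 7)) = g * tricycle 0 1 2 * g⁻¹ ∧
      (φ (gen 1) : Perm (Fin 7)) = g * tricycle 0 1 3 * g⁻¹ := by
  obtain ⟨k, hk⟩ := exists_image_gen_eq_conj φ 0
  obtain ⟨l, hl⟩ := exists_image_gen_eq_conj φ 1
  let ψ : alternatingGroup (Fin 7) →* Perm (Fin 7) :=
    (MulAut.conj k⁻¹).toMonoidHom.comp ((alternatingGroup (Fin 7)).subtype.comp φ.toMonoidHom)
  have hψ : ∀ x, ψ x = k⁻¹ * φ x * k := fun x => by simp [ψ]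
  have hψinj : Function.Injective ψ :=
    (MulAut.conj k⁻¹).injective.comp (Subtype.val_injective.comp φ.injective)
  have hzero : ψ (gen 0) = tricycle 0 1 2 := by rw [hψ, hk]; group
  have hone : ψ (gen 1) = tricycle ((k⁻¹ * l) 0) ((k⁻¹ * l) 1) ((k⁻¹ * l) 2) := by
    rw [hψ, hl, ← conj_tricycle]
    group
  have h := map_gen_mul_gen hψinj (show (0 : Fin 5) ≠ 1 by decide)
  rw [hzero, hone] at h
  have hne : ∀ {a b : Fin 7}, a ≠ b → (k⁻¹ * l) a ≠ (k⁻¹ * l) b := (k⁻¹ * l).injective.ne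
  obtain ⟨y, hy₀, hy₁, hy₂, hy⟩ := exists_common_arrow _ _ _ (hne (by decide))
    (hne (by decide)) (hne (by decide)) h.1 h.2
  rw [← hone] at hy
  obtain ⟨g, hg₀, hg₁⟩ : ∃ g : Perm (Fin 7), ψ (gen 0) = g * tricycle 0 1 2 * g⁻¹ ∧
      ψ (gen 1) = g * tricycle 0 1 3 * g⁻¹ := by
    rcases hy with hy | hy | hy
    · rw [hzero, hy]
      exact exists_conj_of_arrow (by decide) (by decide) (by decide) hy₀.symm hy₁.symm hy₂.symm
    · rw [hzero.trans (tricycle_rotate (by decide) (by decide) (by decide)), hy]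
      exact exists_conj_of_arrow (by decide) (by decide) (by decide) hy₁.symm hy₂.symm hy₀.symm
    · rw [hzero.trans (tricycle_rotate (by decide) (by decide) (by decide)).symm, hy]
      exact exists_conj_of_arrow (by decide) (by decide) (by decide) hy₂.symm hy₀.symm hy₁.symm
  rw [hψ] at hg₀ hg₁
  refine ⟨k * g, ?_, ?_⟩
  · calc (φ (gen 0) : Perm (Fin 7)) = k * (k⁻¹ * φ (gen 0) * k) * k⁻¹ := by group
      _ = k * g * tricycle 0 1 2 * (k * g)⁻¹ := by rw [hg₀]; group
  · calc (φ (gen 1) : Perm (Fin 7)) = k * (k⁻¹ * φ (gen 1) * k) * k⁻¹ := by group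
      _ = k * g * tricycle 0 1 3 * (k * g)⁻¹ := by rw [hg₁]; group

end AlternatingSeven

open AlternatingSeven

theorem every_automorphism_of_A7_is_conjugation_by_S7 :
    ∀ φ : MulAut (alternatingGroup (Fin 7)),
      ∃ g : Perm (Fin 7),
        ∀ x : alternatingGroup (Fin 7),
          (↑(φ x) : Perm (Fin 7)) = g * ↑x * g⁻¹ := by
  intro φ
  obtain ⟨g, hzero, hone⟩ := exists_conj_gen_zero_one φ
  let ψ : alternatingGroup (Fin 7) →* Perm (Fin 7) :=
    (MulAut.conj g⁻¹).toMonoidHom.comp ((alternatingGroup (Fin 7)).subtype.comp φ.toMonoidHom)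
  have hψ : ∀ x, ψ x = g⁻¹ * φ x * g := fun x => by simp [ψ]
  have hψinj : Function.Injective ψ :=
    (MulAut.conj g⁻¹).injective.comp (Subtype.val_injective.comp φ.injective)
  have hψzero : ψ (gen 0) = tricycle 0 1 2 := by rw [hψ, hzero]; group
  have hψone : ψ (gen 1) = tricycle 0 1 3 := by rw [hψ, hone]; group
  have hz : ∀ i, ∃ z : Fin 7, z ≠ 0 ∧ z ≠ 1 ∧ ψ (gen i) = tricycle 0 1 z := by
    intro i
    by_cases hi₀ : i = 0
    · exact ⟨2, by decide, by decide, hi₀ ▸ hψzero⟩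
    by_cases hi₁ : i = 1
    · exact ⟨3, by decide, by decide, hi₁ ▸ hψone⟩
    obtain ⟨k, hk⟩ := exists_image_gen_eq_conj φ i
    have hki : ψ (gen i) = tricycle ((g⁻¹ * k) 0) ((g⁻¹ * k) 1) ((g⁻¹ * k) 2) := by
      rw [hψ, hk, ← conj_tricycle]
      group
    have h₀ := map_gen_mul_gen hψinj (Ne.symm hi₀)
    have h₁ := map_gen_mul_gen hψinj (Ne.symm hi₁)
    rw [hψzero, hki] at h₀
    rw [hψone, hki] at h₁
    rw [hki]
    apply exists_eq_tricycle_zero_one _ _ _ _ _ _ h₀.1 h₀.2 h₁.1 h₁.2 <;>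
      exact (g⁻¹ * k).injective.ne (by decide)
  choose z hz₀ hz₁ hz using hz
  have hzinj : Function.Injective z := fun i j hij =>
    gen_injective (hψinj (by rw [hz, hz, hij]))
  obtain ⟨h, hh⟩ := exists_perm_extending (u := id) (v := Fin.cons 0 (Fin.cons 1 z))
    Function.injective_id (by
      rw [Fin.cons_injective_iff, Fin.cons_injective_iff]
      refine ⟨?_, by simpa using hz₁, hzinj⟩
      rintro ⟨i, hi⟩
      revert hi
      refine Fin.cases (by simp) (fun j => ?_) i
      simpa using hz₀ j)
  have hψh : ψ = (MulAut.conj h).toMonoidHom.comp (alternatingGroup (Fin 7)).subtype := by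
    refine MonoidHom.eq_of_eqOn_top fun x _ => ?_
    have htop := eq_top_of_gen_mem (K := ψ.eqLocus
      ((MulAut.conj h).toMonoidHom.comp (alternatingGroup (Fin 7)).subtype)) fun i => by
        change ψ (gen i) = h * tricycle 0 1 i.succ.succ * h⁻¹
        rw [hz, conj_tricycle]
        have e₀ : h 0 = 0 := hh 0
        have e₁ : h 1 = 1 := hh 1
        have e₂ : h i.succ.succ = z i := hh i.succ.succ
        rw [e₀, e₁, e₂]
    exact (htop ▸ Subgroup.mem_top x :)
  refine ⟨g * h, fun x => ?_⟩
  have hx : g⁻¹ * φ x * g = h * x * h⁻¹ := (hψ x).symm.trans (DFunLike.congr_fun hψh x)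
  calc (φ x : Perm (Fin 7)) = g * (g⁻¹ * φ x * g) * g⁻¹ := by group
    _ = g * h * x * (g * h)⁻¹ := by rw [hx]; group
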